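/- For every nonnegative integer n, a̅₅(25n) = 6·a̅₅(5n) − 5·a̅₅(n). -/

import Mathlib

open scoped BigOperators

/-- The q-Pochhammer infinite product `(a; q)_∞ = ∏_{k≥0} (1 - a q^k)`. -/
noncomputable def qpoch (a q : ℂ) : ℂ := ∏' k : ℕ, (1 - a * q ^ k)

/-- `φ(-q) = (q;q)_∞² / (q²;q²)_∞`. -/
noncomputable def phiNeg (q : ℂ) : ℂ := qpoch q q ^ 2 / qpoch (q ^ 2) (q ^ 2)

/-- `ψ(-q) = (q;q)_∞ (q⁴;q⁴)_∞ / (q²;q²)_∞`. -/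
noncomputable def psiNeg (q : ℂ) : ℂ :=
  qpoch q q * qpoch (q ^ 4) (q ^ 4) / qpoch (q ^ 2) (q ^ 2)

open Filter Topology Finset

lemma norm_mul_pow_summable {q : ℂ} (hq : ‖q‖ < 1) : Summable fun k : ℕ => ‖-(q * q ^ k)‖ := by
  simp only [norm_neg, norm_mul, norm_pow]
  exact (summable_geometric_of_lt_one (norm_nonneg _) hq).mul_left _

lemma qp_mult {q : ℂ} (hq : ‖q‖ < 1) : Multipliable fun k : ℕ => (1 - q * q ^ k) := by
  simpa [sub_eq_add_neg] using multipliable_one_add_of_summable (norm_mul_pow_summable hq)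

lemma qp_mult' {q : ℂ} (hq : ‖q‖ < 1) : Multipliable fun k : ℕ => (1 + q * q ^ k) := by
  have h := norm_mul_pow_summable hq
  simp only [norm_neg] at h
  exact multipliable_one_add_of_summable h

lemma pow_succ_norm_lt {q : ℂ} (hq : ‖q‖ < 1) (k : ℕ) : ‖q * q ^ k‖ < 1 := by
  rw [← pow_succ', norm_pow]
  exact pow_lt_one₀ (norm_nonneg _) hq (by omega)

lemma one_sub_ne {q : ℂ} (hq : ‖q‖ < 1) (k : ℕ) : 1 - q * q ^ k ≠ 0 := by
  intro h
  have h1 := pow_succ_norm_lt hq k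
  rw [← sub_eq_zero.mp h] at h1
  simp at h1

lemma one_add_ne {q : ℂ} (hq : ‖q‖ < 1) (k : ℕ) : 1 + q * q ^ k ≠ 0 := by
  intro h
  have h1 := pow_succ_norm_lt hq k
  have : q * q ^ k = -1 := by linear_combination h
  rw [this] at h1
  simp at h1

lemma qpoch_ne {q : ℂ} (hq : ‖q‖ < 1) : qpoch q q ≠ 0 := by
  unfold qpoch
  have := tprod_one_add_ne_zero_of_summable (f := fun k : ℕ => -(q * q ^ k))
    (fun k => by simpa [sub_eq_add_neg] using one_sub_ne hq k) (norm_mul_pow_summable hq)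
  simpa [sub_eq_add_neg] using this

lemma norm_pow_lt {q : ℂ} (hq : ‖q‖ < 1) {k : ℕ} (hk : k ≠ 0) : ‖q ^ k‖ < 1 := by
  rw [norm_pow]
  exact pow_lt_one₀ (norm_nonneg _) hq hk

lemma phiNeg_ne {q : ℂ} (hq : ‖q‖ < 1) : phiNeg q ≠ 0 := by
  unfold phiNeg
  exact div_ne_zero (pow_ne_zero _ (qpoch_ne hq)) (qpoch_ne (norm_pow_lt hq two_ne_zero))

/-! Gauss identity -/

noncomputable def gA (q : ℂ) (n : ℕ) : ℂ := ∏ k ∈ range n, (1 - q * q ^ k)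
noncomputable def gB (q : ℂ) (n : ℕ) : ℂ := ∏ k ∈ range n, (1 + q * q ^ k)
noncomputable def gS (q : ℂ) (n : ℕ) : ℂ := 1 + 2 * ∑ k ∈ range n, (-1) ^ (k + 1) * q ^ ((k + 1) ^ 2)
noncomputable def gc (q : ℂ) : ℕ → ℂ
  | 0 => 1
  | k + 1 => -gc q k * (1 + q ^ k) / (1 - q * q ^ k)

lemma gc_succ {q : ℂ} (hq : ‖q‖ < 1) (k : ℕ) :
    gc q (k + 1) * (1 - q * q ^ k) = -gc q k * (1 + q ^ k) := by
  rw [gc]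
  exact div_mul_cancel₀ _ (one_sub_ne hq k)

lemma gc_gA {q : ℂ} (hq : ‖q‖ < 1) (n : ℕ) :
    gc q (n + 1) * gA q (n + 1) = 2 * (-1) ^ (n + 1) * gB q n := by
  induction n with
  | zero =>
    have := gc_succ hq 0
    simp [gA, gB, gc] at this ⊢
    rw [this]; norm_num
  | succ n ih =>
    have h1 : gA q (n + 2) = gA q (n + 1) * (1 - q * q ^ (n + 1)) := by
      simp [gA, prod_range_succ]
    have h2 : gB q (n + 1) = gB q n * (1 + q * q ^ n) := by
      simp [gB, prod_range_succ]
    have h3 := gc_succ hq (n + 1)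
    rw [h1, h2]
    linear_combination gA q (n + 1) * h3 - (1 + q ^ (n + 1)) * ih

lemma g_tele {q : ℂ} (hq : ‖q‖ < 1) (N m : ℕ) :
    ∑ k ∈ range m, gc q k * q ^ (k * N) * ((1 - q ^ N) * q ^ k - (1 + q ^ N)) =
      gc q m * (1 - q ^ m) * q ^ (m * N) := by
  induction m with
  | zero => simp
  | succ m ih =>
    rw [sum_range_succ, ih]
    have h := gc_succ hq m
    have e : q ^ ((m + 1) * N) = q ^ (m * N) * q ^ N := by ring
    rw [e]
    have e2 : q ^ (m + 1) = q * q ^ m := by ring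
    rw [e2]
    linear_combination - q ^ (m * N) * q ^ N * h

lemma g_main {q : ℂ} (hq : ‖q‖ < 1) (n : ℕ) :
    (∑ k ∈ range (n + 1), gc q k * q ^ (k * (n + 1))) * gA q n = gS q n * gB q n := by
  induction n with
  | zero => simp [gc, gA, gB, gS]
  | succ n ih =>
    have hA : gA q (n + 1) = gA q n * (1 - q * q ^ n) := by simp [gA, prod_range_succ]
    have hB : gB q (n + 1) = gB q n * (1 + q * q ^ n) := by simp [gB, prod_range_succ]
    have hS : gS q (n + 1) = gS q n + 2 * ((-1) ^ (n + 1) * q ^ ((n + 1) ^ 2)) := by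
      simp [gS, sum_range_succ]; ring
    have ht := g_tele hq (n + 1) (n + 1)
    have hsum : ∑ k ∈ range (n + 1), gc q k * q ^ (k * (n + 1)) *
        ((1 - q ^ (n + 1)) * q ^ k - (1 + q ^ (n + 1))) =
        (1 - q ^ (n + 1)) * ∑ k ∈ range (n + 1), gc q k * q ^ (k * (n + 1 + 1))
        - (1 + q ^ (n + 1)) * ∑ k ∈ range (n + 1), gc q k * q ^ (k * (n + 1)) := by
      rw [mul_sum, mul_sum, ← sum_sub_distrib]
      refine sum_congr rfl fun k _ => ?_
      ring
    rw [hsum] at ht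
    have hc := gc_gA hq n
    rw [sum_range_succ]
    rw [hA] at hc ⊢
    rw [hB, hS]
    have e2 : q ^ (n + 1) = q * q ^ n := by ring
    have e3 : q ^ ((n + 1) * (n + 1 + 1)) = q ^ ((n + 1) ^ 2) * (q * q ^ n) := by ring
    have e4 : q ^ ((n + 1) * (n + 1)) = q ^ ((n + 1) ^ 2) := by ring
    rw [e3]
    rw [e2, e4] at ht
    generalize ∑ k ∈ range (n + 1), gc q k * q ^ (k * (n + 1 + 1)) = X at *
    generalize ∑ k ∈ range (n + 1), gc q k * q ^ (k * (n + 1)) = Y at *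
    linear_combination gA q n * ht + (1 + q * q ^ n) * ih
      + (1 + q * q ^ n) * q ^ ((n + 1) ^ 2) * hc

lemma gA_tendsto {q : ℂ} (hq : ‖q‖ < 1) : Tendsto (gA q) atTop (𝓝 (qpoch q q)) :=
  (qp_mult hq).hasProd.tendsto_prod_nat

lemma gB_tendsto {q : ℂ} (hq : ‖q‖ < 1) :
    Tendsto (gB q) atTop (𝓝 (∏' k : ℕ, (1 + q * q ^ k))) :=
  (qp_mult' hq).hasProd.tendsto_prod_nat

lemma gA_ne {q : ℂ} (hq : ‖q‖ < 1) (n : ℕ) : gA q n ≠ 0 :=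
  prod_ne_zero_iff.mpr fun k _ => one_sub_ne hq k

lemma gc_bdd {q : ℂ} (hq : ‖q‖ < 1) : ∃ C, ∀ k, ‖gc q (k + 1)‖ ≤ C := by
  have h : Tendsto (fun n => ‖2 * gB q n / gA q (n + 1)‖) atTop
      (𝓝 ‖2 * (∏' k : ℕ, (1 + q * q ^ k)) / qpoch q q‖) :=
    (((gB_tendsto hq).const_mul 2).div
      ((gA_tendsto hq).comp (tendsto_add_atTop_nat 1)) (qpoch_ne hq)).norm
  obtain ⟨C, hC⟩ := h.bddAbove_range
  refine ⟨C, fun k => ?_⟩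
  have := hC ⟨k, rfl⟩
  refine le_trans (le_of_eq ?_) this
  have h1 : gc q (k + 1) = (-1) ^ (k + 1) * (2 * gB q k / gA q (k + 1)) := by
    rw [← mul_div_assoc, eq_div_iff (gA_ne hq _), gc_gA hq]; ring
  rw [h1, norm_mul]; simp

lemma g_sum_tendsto {q : ℂ} (hq : ‖q‖ < 1) :
    Tendsto (fun n => ∑ k ∈ range (n + 1), gc q k * q ^ (k * (n + 1))) atTop (𝓝 1) := by
  obtain ⟨C, hC⟩ := gc_bdd hq
  have h0 : Tendsto (fun n : ℕ => C * ((n : ℝ) * ‖q‖ ^ n)) atTop (𝓝 0) := by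
    simpa using (tendsto_self_mul_const_pow_of_lt_one (norm_nonneg q) hq).const_mul C
  rw [tendsto_iff_norm_sub_tendsto_zero]
  refine squeeze_zero (fun _ => norm_nonneg _) (fun n => ?_) h0
  rw [sum_range_succ']
  simp only [gc, zero_mul, pow_zero, mul_one, add_sub_cancel_right]
  have hC0 : 0 ≤ C := le_trans (norm_nonneg _) (hC 0)
  calc _ ≤ ∑ k ∈ range n, C * ‖q‖ ^ n := by
        refine norm_sum_le_of_le _ fun k _ => ?_
        have := hC k
        simp only [gc] at this
        rw [norm_mul, norm_pow]
        refine mul_le_mul this ?_ (by positivity) hC0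
        exact pow_le_pow_of_le_one (norm_nonneg _) hq.le (by nlinarith)
    _ = _ := by simp; ring

lemma qpoch_sq {q : ℂ} (hq : ‖q‖ < 1) :
    qpoch (q ^ 2) (q ^ 2) = qpoch q q * ∏' k : ℕ, (1 + q * q ^ k) := by
  unfold qpoch
  rw [← (qp_mult hq).tprod_mul (qp_mult' hq)]
  refine tprod_congr fun k => ?_
  ring

lemma gS_tendsto {q : ℂ} (hq : ‖q‖ < 1) : Tendsto (gS q) atTop (𝓝 (phiNeg q)) := by
  have hB : (∏' k : ℕ, (1 + q * q ^ k)) ≠ 0 := by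
    intro h
    have := qpoch_ne (norm_pow_lt hq two_ne_zero)
    rw [qpoch_sq hq, h] at this
    simp at this
  have h1 := ((g_sum_tendsto hq).mul (gA_tendsto hq)).div (gB_tendsto hq) hB
  have h2 : 1 * qpoch q q / (∏' k : ℕ, (1 + q * q ^ k)) = phiNeg q := by
    rw [phiNeg, qpoch_sq hq]
    have := qpoch_ne hq
    field_simp
  rw [h2] at h1
  refine h1.congr fun n => ?_
  have hn : gB q n ≠ 0 := prod_ne_zero_iff.mpr fun k _ => one_add_ne hq k
  simp only [Pi.div_apply]
  rw [g_main hq, mul_div_cancel_right₀ _ hn]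

/-- theta summand -/
noncomputable def th (q : ℂ) (n : ℤ) : ℂ := (-1) ^ n.natAbs * q ^ (n.natAbs ^ 2)

lemma th_nat_summable {q : ℂ} (hq : ‖q‖ < 1) : Summable fun n : ℕ => ‖th q n‖ := by
  refine Summable.of_nonneg_of_le (fun _ => norm_nonneg _) (fun n => ?_)
    (summable_geometric_of_lt_one (norm_nonneg q) hq)
  simp only [th, Int.natAbs_natCast, norm_mul, norm_pow, norm_neg, norm_one, one_pow, one_mul]
  exact pow_le_pow_of_le_one (norm_nonneg _) hq.le (by nlinarith [Nat.le_self_pow two_ne_zero n])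

lemma th_neg (q : ℂ) (n : ℤ) : th q (-n) = th q n := by simp [th]

lemma th_summable_norm {q : ℂ} (hq : ‖q‖ < 1) : Summable fun n : ℤ => ‖th q n‖ :=
  Summable.of_nat_of_neg (th_nat_summable hq) (by simpa [th_neg] using th_nat_summable hq)

lemma th_summable {q : ℂ} (hq : ‖q‖ < 1) : Summable (th q) := (th_summable_norm hq).of_norm

lemma phiNeg_eq {q : ℂ} (hq : ‖q‖ < 1) : phiNeg q = ∑' n : ℤ, th q n := by
  have hs : Summable fun n : ℕ => th q n := (th_nat_summable hq).of_norm
  have h1 : HasSum (fun n : ℕ => th q (n : ℤ)) (∑' n : ℕ, th q n) := hs.hasSum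
  have h2 : HasSum (fun n : ℕ => th q (-(n : ℤ))) (∑' n : ℕ, th q n) := by
    simpa [th_neg] using h1
  have h3 := (HasSum.of_nat_of_neg h1 h2).tsum_eq
  rw [h3]
  have h4 := (h1.tendsto_sum_nat.comp (tendsto_add_atTop_nat 1))
  have h5 := (h4.add h4).sub_const (th q 0)
  refine tendsto_nhds_unique (gS_tendsto hq) (h5.congr fun n => ?_)
  simp only [Function.comp, gS]
  rw [sum_range_succ']
  simp [th]
  simp only [show ∀ x : ℕ, ((x : ℤ) + 1).natAbs = x + 1 by intro x; omega]
  ring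

/-! Product over fifth roots of unity -/

lemma norm_root_mul {ζ q : ℂ} (hζ : IsPrimitiveRoot ζ 5) (hq : ‖q‖ < 1) (k : ℕ) :
    ‖ζ ^ k * q‖ < 1 := by
  rw [norm_mul, norm_pow, hζ.norm'_eq_one (by norm_num)]; simpa using hq

lemma root_pow5 {ζ : ℂ} (hζ : IsPrimitiveRoot ζ 5) : ζ ^ 5 = 1 := hζ.pow_eq_one

lemma root_sum {ζ : ℂ} (hζ : IsPrimitiveRoot ζ 5) : 1 + ζ + ζ ^ 2 + ζ ^ 3 + ζ ^ 4 = 0 := by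
  have := hζ.geom_sum_eq_zero (by norm_num)
  simpa [sum_range_succ] using this

lemma prod_five {ζ : ℂ} (hζ : IsPrimitiveRoot ζ 5) (x : ℂ) :
    ∏ k ∈ range 5, (1 - ζ ^ k * x) = 1 - x ^ 5 := by
  have h := root_sum hζ
  have h5 := root_pow5 hζ
  simp only [prod_range_succ, prod_range_zero]
  have hs : (ζ + ζ ^ 4) ^ 2 + (ζ + ζ ^ 4) - 1 = 0 := by
    linear_combination h + (ζ ^ 3 + 2) * h5
  have ht : (ζ ^ 2 + ζ ^ 3) = -1 - (ζ + ζ ^ 4) := by linear_combination h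
  have e1 : (1 - ζ ^ 1 * x) * (1 - ζ ^ 4 * x) = 1 - (ζ + ζ ^ 4) * x + x ^ 2 := by
    linear_combination x ^ 2 * h5
  have e2 : (1 - ζ ^ 2 * x) * (1 - ζ ^ 3 * x) = 1 - (ζ ^ 2 + ζ ^ 3) * x + x ^ 2 := by
    linear_combination x ^ 2 * h5
  rw [ht] at e2
  generalize ζ + ζ ^ 4 = s at *
  calc _ = (1 - x) * ((1 - ζ ^ 1 * x) * (1 - ζ ^ 4 * x)) * ((1 - ζ ^ 2 * x) * (1 - ζ ^ 3 * x)) := by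
        ring
    _ = _ := by rw [e1, e2]; linear_combination -(1 - x) * x ^ 2 * hs

lemma prim_pow {ζ : ℂ} (hζ : IsPrimitiveRoot ζ 5) {m : ℕ} (hm : ¬ 5 ∣ m) :
    IsPrimitiveRoot (ζ ^ m) 5 :=
  hζ.pow_of_coprime m (((Nat.Prime.coprime_iff_not_dvd (by norm_num)).mpr hm).symm)

lemma prod_five_pow {ζ : ℂ} (hζ : IsPrimitiveRoot ζ 5) (q : ℂ) (m : ℕ) :
    ∏ k ∈ range 5, (1 - (ζ ^ k * q) ^ m) = if 5 ∣ m then (1 - q ^ m) ^ 5 else 1 - (q ^ 5) ^ m := by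
  split_ifs with h
  · obtain ⟨j, rfl⟩ := h
    have : ∀ k, (ζ ^ k * q) ^ (5 * j) = q ^ (5 * j) := by
      intro k
      rw [mul_pow, ← pow_mul, show k * (5 * j) = 5 * (k * j) by ring, pow_mul, root_pow5 hζ]; simp
    simp [this]
  · have h1 := prod_five (prim_pow hζ h) (q ^ m)
    rw [← pow_mul, mul_comm 5 m, pow_mul, ← h1]
    refine prod_congr rfl fun k _ => ?_
    ring

lemma inj5 : Function.Injective fun m : ℕ => 5 * m + 4 := fun a b h => by simpa using h

lemma qpoch_five {ζ q : ℂ} (hζ : IsPrimitiveRoot ζ 5) (hq : ‖q‖ < 1) :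
    (∏ k ∈ range 5, qpoch (ζ ^ k * q) (ζ ^ k * q)) * qpoch (q ^ 25) (q ^ 25) =
      qpoch (q ^ 5) (q ^ 5) ^ 6 := by
  have hq5 : ‖q ^ 5‖ < 1 := norm_pow_lt hq (by norm_num)
  have hq25 : ‖q ^ 25‖ < 1 := norm_pow_lt hq (by norm_num)
  set u : ℕ → ℂ := fun n => if 5 ∣ n + 1 then 1 - (q ^ 5) ^ (n + 1) else 1 with hu
  set v : ℕ → ℂ := fun n => if 5 ∣ n + 1 then 1 - q ^ (n + 1) else 1 with hv
  have hur : ∀ n ∉ Set.range (fun m : ℕ => 5 * m + 4), u n = 1 := by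
    intro n hn
    simp only [hu]
    rw [if_neg]
    rintro ⟨j, hj⟩
    exact hn ⟨j - 1, by simp only; omega⟩
  have hvr : ∀ n ∉ Set.range (fun m : ℕ => 5 * m + 4), v n = 1 := by
    intro n hn
    simp only [hv]
    rw [if_neg]
    rintro ⟨j, hj⟩
    exact hn ⟨j - 1, by simp only; omega⟩
  have huc : ∀ m, u (5 * m + 4) = 1 - q ^ 25 * (q ^ 25) ^ m := by
    intro m
    simp only [hu]
    rw [if_pos ⟨m + 1, by ring⟩]; ring
  have hvc : ∀ m, v (5 * m + 4) = 1 - q ^ 5 * (q ^ 5) ^ m := by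
    intro m
    simp only [hv]
    rw [if_pos ⟨m + 1, by ring⟩]; ring
  have hum : Multipliable u := by
    rw [← inj5.multipliable_iff hur]
    refine (qp_mult hq25).congr fun m => ?_
    simp [huc]
  have hvm : Multipliable v := by
    rw [← inj5.multipliable_iff hvr]
    refine (qp_mult hq5).congr fun m => ?_
    simp [hvc]
  have e1 : qpoch (q ^ 25) (q ^ 25) = ∏' n, u n := by
    rw [qpoch, ← inj5.tprod_eq (f := u)]
    · exact tprod_congr fun m => (huc m).symm
    · intro n hn
      by_contra h
      exact hn (hur n h)
  have e2 : qpoch (q ^ 5) (q ^ 5) = ∏' n, v n := by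
    rw [qpoch, ← inj5.tprod_eq (f := v)]
    · exact tprod_congr fun m => (hvc m).symm
    · intro n hn
      by_contra h
      exact hn (hvr n h)
  have hm : ∀ k ∈ range 5, Multipliable fun n : ℕ => 1 - (ζ ^ k * q) * (ζ ^ k * q) ^ n :=
    fun k _ => qp_mult (norm_root_mul hζ hq k)
  have e3 : ∏ k ∈ range 5, qpoch (ζ ^ k * q) (ζ ^ k * q) =
      ∏' n : ℕ, ∏ k ∈ range 5, (1 - (ζ ^ k * q) * (ζ ^ k * q) ^ n) :=
    (Multipliable.tprod_finsetProd hm).symm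
  have hm' : Multipliable fun n : ℕ => ∏ k ∈ range 5, (1 - (ζ ^ k * q) * (ζ ^ k * q) ^ n) :=
    multipliable_prod hm
  calc _ = (∏' n : ℕ, ∏ k ∈ range 5, (1 - (ζ ^ k * q) * (ζ ^ k * q) ^ n)) * ∏' n, u n := by
        rw [e3, e1]
    _ = ∏' n : ℕ, ((∏ k ∈ range 5, (1 - (ζ ^ k * q) * (ζ ^ k * q) ^ n)) * u n) :=
        (hm'.tprod_mul hum).symm
    _ = ∏' n : ℕ, ((1 - q ^ 5 * (q ^ 5) ^ n) * v n ^ 5) := by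
        refine tprod_congr fun n => ?_
        simp only [← pow_succ']
        rw [prod_five_pow hζ]
        simp only [hu, hv]
        split_ifs <;> ring
    _ = (∏' n : ℕ, (1 - q ^ 5 * (q ^ 5) ^ n)) * (∏' n, v n) ^ 5 := by
        rw [(qp_mult hq5).tprod_mul (hvm.pow 5), hvm.tprod_pow]
    _ = _ := by
        rw [← e2]
        change qpoch (q ^ 5) (q ^ 5) * _ = _
        ring

lemma phiNeg_five {ζ q : ℂ} (hζ : IsPrimitiveRoot ζ 5) (hq : ‖q‖ < 1) :
    (∏ k ∈ range 5, phiNeg (ζ ^ k * q)) * phiNeg (q ^ 25) = phiNeg (q ^ 5) ^ 6 := by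
  have h1 := qpoch_five hζ hq
  have h2 := qpoch_five (prim_pow hζ (m := 2) (by norm_num)) (norm_pow_lt hq two_ne_zero)
  have e : ∀ k, (ζ ^ 2) ^ k * q ^ 2 = (ζ ^ k * q) ^ 2 := by intro k; ring
  simp only [e] at h2
  have e25 : (q ^ 2) ^ 25 = (q ^ 25) ^ 2 := by ring
  have e5 : (q ^ 2) ^ 5 = (q ^ 5) ^ 2 := by ring
  rw [e25, e5] at h2
  simp only [phiNeg]
  rw [prod_div_distrib, prod_pow, div_mul_div_comm, h2, ← mul_pow, h1]
  ring

/-! Dissection of theta -/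

lemma zsq_mod (n : ℤ) : (5 ∣ n ∧ n.natAbs ^ 2 % 5 = 0) ∨ (¬ 5 ∣ n ∧ n.natAbs ^ 2 % 5 = 1) ∨
    (¬ 5 ∣ n ∧ n.natAbs ^ 2 % 5 = 4) := by
  have h : n.natAbs % 5 = 0 ∨ n.natAbs % 5 = 1 ∨ n.natAbs % 5 = 2 ∨ n.natAbs % 5 = 3 ∨
    n.natAbs % 5 = 4 := by omega
  have h' : (5 : ℤ) ∣ n ↔ n.natAbs % 5 = 0 := by omega
  rw [h', Nat.pow_mod]
  rcases h with h | h | h | h | h <;> simp [h]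

noncomputable def thr (q : ℂ) (r : ℕ) (n : ℤ) : ℂ := if n.natAbs ^ 2 % 5 = r then th q n else 0

lemma thr_summable {q : ℂ} (hq : ‖q‖ < 1) (r : ℕ) : Summable (thr q r) := by
  refine Summable.of_norm_bounded (th_summable_norm hq) fun n => ?_
  unfold thr
  split_ifs <;> simp

lemma th_root {ζ : ℂ} (hζ : IsPrimitiveRoot ζ 5) (q : ℂ) (k : ℕ) (n : ℤ) :
    th (ζ ^ k * q) n = thr q 0 n + ζ ^ k * thr q 1 n + ζ ^ (4 * k) * thr q 4 n := by
  have h5 := root_pow5 hζ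
  have key : ∀ m : ℕ, (ζ ^ k) ^ m = ζ ^ (k * (m % 5)) := by
    intro m
    conv_lhs => rw [← Nat.div_add_mod m 5]
    rw [← pow_mul, mul_add, pow_add, show k * (5 * (m / 5)) = 5 * (k * (m / 5)) by ring, pow_mul, h5]
    simp
  have e : th (ζ ^ k * q) n = ζ ^ (k * (n.natAbs ^ 2 % 5)) * th q n := by
    simp only [th]
    rw [mul_pow, key]; ring
  rw [e]
  simp only [thr]
  rcases zsq_mod n with ⟨_, h⟩ | ⟨_, h⟩ | ⟨_, h⟩ <;> simp [h, mul_comm]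

lemma phiNeg_root {ζ q : ℂ} (hζ : IsPrimitiveRoot ζ 5) (hq : ‖q‖ < 1) (k : ℕ) :
    phiNeg (ζ ^ k * q) = ∑' n, thr q 0 n + ζ ^ k * ∑' n, thr q 1 n + ζ ^ (4 * k) * ∑' n, thr q 4 n := by
  rw [phiNeg_eq (norm_root_mul hζ hq k), ← tsum_mul_left, ← tsum_mul_left,
    ← (thr_summable hq 0).tsum_add ((thr_summable hq 1).mul_left _),
    ← ((thr_summable hq 0).add ((thr_summable hq 1).mul_left _)).tsum_add
      ((thr_summable hq 4).mul_left _)]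
  exact tsum_congr fun n => th_root hζ q k n

lemma th_five_mul (q : ℂ) (n : ℤ) : th q (5 * n) = th (q ^ 25) n := by
  simp only [th, Int.natAbs_mul]
  rw [pow_mul, ← pow_mul q]
  norm_num
  ring

lemma thr_zero {q : ℂ} (hq : ‖q‖ < 1) : ∑' n, thr q 0 n = phiNeg (q ^ 25) := by
  rw [phiNeg_eq (norm_pow_lt hq (by norm_num))]
  have hi : Function.Injective fun n : ℤ => 5 * n := fun a b h => by simpa using h
  rw [← hi.tsum_eq]
  · refine tsum_congr fun n => ?_
    rw [← th_five_mul, thr, if_pos]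
    rcases zsq_mod (5 * n) with h | h | h <;> simp_all
  · intro n hn
    rcases zsq_mod n with ⟨⟨j, hj⟩, _⟩ | ⟨_, h⟩ | ⟨_, h⟩
    · exact ⟨j, hj.symm⟩
    · simp [thr, h] at hn
    · simp [thr, h] at hn

lemma sq_mod_val (n : ℤ) : n.natAbs ^ 2 % 5 = ((n % 5) ^ 2 % 5).toNat := by
  have h1 : ((n.natAbs ^ 2 % 5 : ℕ) : ℤ) = (n % 5) ^ 2 % 5 := by
    push_cast
    rw [sq_abs]
    exact ((Int.mod_modEq n 5).pow 2).symm
  omega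

lemma pair_pointwise (q : ℂ) (x y : ℤ) :
    thr q 1 x * thr q 4 y + thr q 4 x * thr q 1 y + 2 * (thr q 0 x * thr q 0 y) =
      (if 5 ∣ x - 2 * y then th q x * th q y else 0) +
      (if 5 ∣ x + 2 * y then th q x * th q y else 0) := by
  have h1 : (5 ∣ x - 2 * y) ↔ (x % 5 - 2 * (y % 5)) % 5 = 0 := by omega
  have h2 : (5 ∣ x + 2 * y) ↔ (x % 5 + 2 * (y % 5)) % 5 = 0 := by omega
  simp only [thr, sq_mod_val, h1, h2]
  have hx : x % 5 = 0 ∨ x % 5 = 1 ∨ x % 5 = 2 ∨ x % 5 = 3 ∨ x % 5 = 4 := by omega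
  have hy : y % 5 = 0 ∨ y % 5 = 1 ∨ y % 5 = 2 ∨ y % 5 = 3 ∨ y % 5 = 4 := by omega
  rcases hx with hx | hx | hx | hx | hx <;> rcases hy with hy | hy | hy | hy | hy <;>
    simp [hx, hy, two_mul]

lemma th_pair (q : ℂ) (u v : ℤ) :
    th q (2 * u - v) * th q (u + 2 * v) = th (q ^ 5) u * th (q ^ 5) v := by
  simp only [th]
  have h1 : (2 * u - v).natAbs ^ 2 + (u + 2 * v).natAbs ^ 2 = 5 * (u.natAbs ^ 2 + v.natAbs ^ 2) := by
    zify
    simp only [sq_abs]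
    ring
  have h2 : (-1 : ℂ) ^ ((2 * u - v).natAbs + (u + 2 * v).natAbs) = (-1) ^ (u.natAbs + v.natAbs) := by
    rw [neg_one_pow_eq_pow_mod_two]
    conv_rhs => rw [neg_one_pow_eq_pow_mod_two]
    congr 1
    omega
  calc _ = (-1 : ℂ) ^ ((2 * u - v).natAbs + (u + 2 * v).natAbs) *
        q ^ ((2 * u - v).natAbs ^ 2 + (u + 2 * v).natAbs ^ 2) := by rw [pow_add, pow_add]; ring
    _ = _ := by rw [h1, h2, pow_mul, pow_add, pow_add]; ring

lemma pair_summable {f g : ℤ → ℂ} {q : ℂ} (hq : ‖q‖ < 1) (hf : ∀ n, ‖f n‖ ≤ ‖th q n‖)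
    (hg : ∀ n, ‖g n‖ ≤ ‖th q n‖) : Summable fun z : ℤ × ℤ => f z.1 * g z.2 :=
  summable_mul_of_summable_norm
    (Summable.of_nonneg_of_le (fun _ => norm_nonneg _) hf (th_summable_norm hq))
    (Summable.of_nonneg_of_le (fun _ => norm_nonneg _) hg (th_summable_norm hq))

lemma pair_tsum {f g : ℤ → ℂ} {q : ℂ} (hq : ‖q‖ < 1) (hf : ∀ n, ‖f n‖ ≤ ‖th q n‖)
    (hg : ∀ n, ‖g n‖ ≤ ‖th q n‖) :
    (∑' n, f n) * (∑' n, g n) = ∑' z : ℤ × ℤ, f z.1 * g z.2 :=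
  tsum_mul_tsum_of_summable_norm
    (Summable.of_nonneg_of_le (fun _ => norm_nonneg _) hf (th_summable_norm hq))
    (Summable.of_nonneg_of_le (fun _ => norm_nonneg _) hg (th_summable_norm hq))

lemma thr_le (q : ℂ) (r : ℕ) (n : ℤ) : ‖thr q r n‖ ≤ ‖th q n‖ := by
  unfold thr
  split_ifs <;> simp

lemma phi_sq {q : ℂ} (hq : ‖q‖ < 1) :
    phiNeg (q ^ 5) ^ 2 = ∑' z : ℤ × ℤ, th (q ^ 5) z.1 * th (q ^ 5) z.2 := by
  have h5 := norm_pow_lt hq (k := 5) (by norm_num)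
  rw [sq, phiNeg_eq h5]
  exact pair_tsum h5 (fun _ => le_rfl) (fun _ => le_rfl)

lemma tsum_G1 {q : ℂ} (hq : ‖q‖ < 1) :
    ∑' z : ℤ × ℤ, (if 5 ∣ z.1 - 2 * z.2 then th q z.1 * th q z.2 else 0) = phiNeg (q ^ 5) ^ 2 := by
  rw [phi_sq hq]
  have hi : Function.Injective fun z : ℤ × ℤ => (2 * z.1 - z.2, z.1 + 2 * z.2) := by
    rintro ⟨a, b⟩ ⟨c, d⟩ h
    simp only [Prod.mk.injEq] at h ⊢
    omega
  rw [← hi.tsum_eq]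
  · refine tsum_congr fun z => ?_
    rw [if_pos, th_pair]
    simp only
    omega
  · rintro ⟨x, y⟩ hz
    by_cases h : 5 ∣ x - 2 * y
    · obtain ⟨j, hj⟩ := h
      refine ⟨(y + 2 * j, -j), ?_⟩
      simp only [Prod.mk.injEq]
      omega
    · simp [h] at hz

lemma tsum_G2 {q : ℂ} (hq : ‖q‖ < 1) :
    ∑' z : ℤ × ℤ, (if 5 ∣ z.1 + 2 * z.2 then th q z.1 * th q z.2 else 0) = phiNeg (q ^ 5) ^ 2 := by
  rw [phi_sq hq]
  have hi : Function.Injective fun z : ℤ × ℤ => (2 * z.1 - z.2, -(z.1 + 2 * z.2)) := by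
    rintro ⟨a, b⟩ ⟨c, d⟩ h
    simp only [Prod.mk.injEq] at h ⊢
    omega
  rw [← hi.tsum_eq]
  · refine tsum_congr fun z => ?_
    rw [if_pos, th_neg, th_pair]
    simp only
    omega
  · rintro ⟨x, y⟩ hz
    by_cases h : 5 ∣ x + 2 * y
    · obtain ⟨j, hj⟩ := h
      refine ⟨(-y + 2 * j, -j), ?_⟩
      simp only [Prod.mk.injEq]
      omega
    · simp [h] at hz

lemma bc_eq {q : ℂ} (hq : ‖q‖ < 1) :
    (∑' n, thr q 1 n) * (∑' n, thr q 4 n) = phiNeg (q ^ 5) ^ 2 - phiNeg (q ^ 25) ^ 2 := by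
  have s14 := pair_summable hq (thr_le q 1) (thr_le q 4)
  have s41 := pair_summable hq (thr_le q 4) (thr_le q 1)
  have s00 := pair_summable hq (thr_le q 0) (thr_le q 0)
  have sF := pair_summable (f := th q) (g := th q) hq (fun _ => le_rfl) (fun _ => le_rfl)
  have sG1 : Summable fun z : ℤ × ℤ => (if 5 ∣ z.1 - 2 * z.2 then th q z.1 * th q z.2 else 0) := by
    refine Summable.of_norm_bounded sF.norm fun z => ?_
    split_ifs <;> simp; positivity
  have sG2 : Summable fun z : ℤ × ℤ => (if 5 ∣ z.1 + 2 * z.2 then th q z.1 * th q z.2 else 0) := by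
    refine Summable.of_norm_bounded sF.norm fun z => ?_
    split_ifs <;> simp; positivity
  have h : ∑' z : ℤ × ℤ, (thr q 1 z.1 * thr q 4 z.2 + thr q 4 z.1 * thr q 1 z.2 +
      2 * (thr q 0 z.1 * thr q 0 z.2)) = phiNeg (q ^ 5) ^ 2 + phiNeg (q ^ 5) ^ 2 := by
    conv_rhs => rw [← tsum_G1 hq]
    nth_rewrite 2 [tsum_G1 hq]
    rw [← tsum_G2 hq, ← sG1.tsum_add sG2]
    exact tsum_congr fun z => pair_pointwise q z.1 z.2
  rw [(s14.add s41).tsum_add (s00.mul_left 2), s14.tsum_add s41, tsum_mul_left,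
    ← pair_tsum hq (thr_le q 1) (thr_le q 4), ← pair_tsum hq (thr_le q 4) (thr_le q 1),
    ← pair_tsum hq (thr_le q 0) (thr_le q 0), thr_zero hq] at h
  linear_combination h / 2

/-! Algebra -/

lemma alg_inv {ζ a b c P : ℂ} (hζ : IsPrimitiveRoot ζ 5) (x : ℕ → ℂ)
    (hx : ∀ k, x k = a + ζ ^ k * b + ζ ^ (4 * k) * c) (hne : ∀ k, x k ≠ 0)
    (hP : P ≠ 0) (ha : a ≠ 0) (hprod : (∏ k ∈ range 5, x k) * a = P ^ 6)
    (hbc : b * c = P ^ 2 - a ^ 2) :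
    ∑ k ∈ range 5, P ^ 5 / x k = 5 * (5 * (a ^ 5 / P) + (a * P ^ 3 - 5 * a ^ 3 * P)) := by
  have h := root_sum hζ
  have h5 := root_pow5 hζ
  have hs : (ζ + ζ ^ 4) ^ 2 + (ζ + ζ ^ 4) - 1 = 0 := by
    linear_combination h + (ζ ^ 3 + 2) * h5
  have ht : (ζ ^ 2 + ζ ^ 3) = -1 - (ζ + ζ ^ 4) := by linear_combination h
  have x0 : x 0 = a + b + c := by rw [hx]; ring
  have x1 : x 1 = a + ζ * b + ζ ^ 4 * c := by rw [hx]; ring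
  have x2 : x 2 = a + ζ ^ 2 * b + ζ ^ 3 * c := by
    rw [hx]; linear_combination ζ ^ 3 * c * h5
  have x3 : x 3 = a + ζ ^ 3 * b + ζ ^ 2 * c := by
    rw [hx]; linear_combination (ζ ^ 7 + ζ ^ 2) * c * h5
  have x4 : x 4 = a + ζ ^ 4 * b + ζ * c := by
    rw [hx]; linear_combination (ζ ^ 11 + ζ ^ 6 + ζ) * c * h5
  have m14 : x 1 * x 4 = a ^ 2 + b ^ 2 + c ^ 2 + (ζ + ζ ^ 4) * (a * (b + c))
      + (ζ ^ 2 + ζ ^ 3) * (b * c) := by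
    rw [x1, x4]; linear_combination (b ^ 2 + c ^ 2 + ζ ^ 3 * b * c) * h5
  have m23 : x 2 * x 3 = a ^ 2 + b ^ 2 + c ^ 2 + (ζ ^ 2 + ζ ^ 3) * (a * (b + c))
      + (ζ + ζ ^ 4) * (b * c) := by
    rw [x2, x3]; linear_combination (b ^ 2 + c ^ 2 + ζ * b * c) * h5
  have p14 : x 1 + x 4 = 2 * a + (ζ + ζ ^ 4) * (b + c) := by rw [x1, x4]; ring
  have p23 : x 2 + x 3 = 2 * a + (ζ ^ 2 + ζ ^ 3) * (b + c) := by rw [x2, x3]; ring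
  rw [ht] at m14 m23 p23
  have e4 : x 1 * x 4 * (x 2 * x 3) + x 0 * ((x 1 + x 4) * (x 2 * x 3) + (x 2 + x 3) * (x 1 * x 4))
      = 5 * (a ^ 4 - 3 * a ^ 2 * (b * c) + (b * c) ^ 2) := by
    rw [m14, m23, p14, p23, x0]
    generalize ζ + ζ ^ 4 = s at *
    linear_combination (-(a * (b + c) - b * c) ^ 2
      - 2 * (a + b + c) * (b + c) * (a * (b + c) - b * c)) * hs
  rw [hbc] at e4
  simp only [sum_range_succ, sum_range_zero, prod_range_succ, prod_range_zero] at hprod ⊢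
  have n0 := hne 0
  have n1 := hne 1
  have n2 := hne 2
  have n3 := hne 3
  have n4 := hne 4
  have hD : x 0 * x 1 * x 2 * x 3 * x 4 ≠ 0 := by positivity
  have key : 0 + P ^ 5 / x 0 + P ^ 5 / x 1 + P ^ 5 / x 2 + P ^ 5 / x 3 + P ^ 5 / x 4 =
      P ^ 5 * (x 1 * x 4 * (x 2 * x 3) +
        x 0 * ((x 1 + x 4) * (x 2 * x 3) + (x 2 + x 3) * (x 1 * x 4))) /
        (x 0 * x 1 * x 2 * x 3 * x 4) := by
    field_simp
    ring
  have hD2 : x 0 * x 1 * x 2 * x 3 * x 4 = P ^ 6 / a := by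
    rw [eq_div_iff ha]; linear_combination hprod
  rw [key, e4, hD2]
  field_simp
  ring

lemma alg_cube {ζ a b c P : ℂ} (hζ : IsPrimitiveRoot ζ 5) (x : ℕ → ℂ)
    (hx : ∀ k, x k = a + ζ ^ k * b + ζ ^ (4 * k) * c)
    (hbc : b * c = P ^ 2 - a ^ 2) :
    ∑ k ∈ range 5, (P * x k ^ 3 - 5 * P ^ 3 * x k) = 5 * (a * P ^ 3 - 5 * a ^ 3 * P) := by
  have h := root_sum hζ
  have h5 := root_pow5 hζ
  have x0 : x 0 = a + b + c := by rw [hx]; ring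
  have x1 : x 1 = a + ζ * b + ζ ^ 4 * c := by rw [hx]; ring
  have x2 : x 2 = a + ζ ^ 2 * b + ζ ^ 3 * c := by
    rw [hx]; linear_combination ζ ^ 3 * c * h5
  have x3 : x 3 = a + ζ ^ 3 * b + ζ ^ 2 * c := by
    rw [hx]; linear_combination (ζ ^ 7 + ζ ^ 2) * c * h5
  have x4 : x 4 = a + ζ ^ 4 * b + ζ * c := by
    rw [hx]; linear_combination (ζ ^ 11 + ζ ^ 6 + ζ) * c * h5
  have hsum : x 0 + x 1 + x 2 + x 3 + x 4 = 5 * a := by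
    rw [x0, x1, x2, x3, x4]; linear_combination (b + c) * h
  have hcube : x 0 ^ 3 + x 1 ^ 3 + x 2 ^ 3 + x 3 ^ 3 + x 4 ^ 3 = 5 * (a ^ 3 + 6 * a * (b * c)) := by
    rw [x0, x1, x2, x3, x4]
    clear hsum x0 x1 x2 x3 x4 hx hbc
    grind
  rw [hbc] at hcube
  simp only [sum_range_succ, sum_range_zero]
  linear_combination P * hcube - 5 * P ^ 3 * hsum

lemma root_pow_sum {ζ : ℂ} (hζ : IsPrimitiveRoot ζ 5) (n : ℕ) :
    ∑ k ∈ range 5, (ζ ^ k) ^ n = if 5 ∣ n then 5 else 0 := by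
  split_ifs with h
  · obtain ⟨j, rfl⟩ := h
    have : ∀ k, (ζ ^ k) ^ (5 * j) = 1 := by
      intro k
      rw [← pow_mul, show k * (5 * j) = 5 * (k * j) by ring, pow_mul, root_pow5 hζ, one_pow]
    simp [this]
  · have := (prim_pow hζ h).geom_sum_eq_zero (by norm_num)
    rw [← this]
    refine sum_congr rfl fun k _ => ?_
    ring

/-- Extraction of the coefficients divisible by five. -/
lemma extract {ζ : ℂ} (hζ : IsPrimitiveRoot ζ 5) (a : ℕ → ℂ) (F G : ℂ → ℂ)
    (hF : ∀ q : ℂ, ‖q‖ < 1 → HasSum (fun n => a n * q ^ n) (F q))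
    (hG : ∀ q : ℂ, ‖q‖ < 1 → ∑ k ∈ range 5, F (ζ ^ k * q) = 5 * G (q ^ 5)) :
    ∀ w : ℂ, ‖w‖ < 1 → HasSum (fun n => a (5 * n) * w ^ n) (G w) := by
  intro w hw
  obtain ⟨q, rfl⟩ := IsAlgClosed.exists_pow_nat_eq w (n := 5) (by norm_num)
  have hq : ‖q‖ < 1 := by
    rw [norm_pow] at hw
    exact (pow_lt_one_iff_of_nonneg (norm_nonneg _) (by norm_num)).mp hw
  have h1 : HasSum (fun n => ∑ k ∈ range 5, a n * (ζ ^ k * q) ^ n) (∑ k ∈ range 5, F (ζ ^ k * q)) :=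
    hasSum_sum fun k _ => hF _ (norm_root_mul hζ hq k)
  rw [hG q hq] at h1
  have h2 := h1.div_const 5
  rw [mul_div_cancel_left₀ _ (by norm_num)] at h2
  have e : ∀ n, (∑ k ∈ range 5, a n * (ζ ^ k * q) ^ n) / 5 = if 5 ∣ n then a n * q ^ n else 0 := by
    intro n
    have : ∑ k ∈ range 5, a n * (ζ ^ k * q) ^ n = a n * q ^ n * ∑ k ∈ range 5, (ζ ^ k) ^ n := by
      rw [mul_sum]
      refine sum_congr rfl fun k _ => ?_
      rw [mul_pow]; ring
    rw [this, root_pow_sum hζ]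
    split_ifs
    · ring
    · simp
  simp only [e] at h2
  have hi : Function.Injective fun m : ℕ => 5 * m := fun a b h => by simpa using h
  rw [← hi.hasSum_iff] at h2
  · refine h2.congr_fun ?_ 
    intro n
    simp [pow_mul]
  · intro n hn
    rw [if_neg]
    rintro ⟨j, rfl⟩
    exact hn ⟨j, rfl⟩

lemma coeff_zero (d : ℕ → ℂ) (h : ∀ q : ℂ, ‖q‖ < 1 → HasSum (fun n => d n * q ^ n) 0) (n : ℕ) :
    d n = 0 := by
  have h1 : HasFPowerSeriesAt (0 : ℂ → ℂ) (FormalMultilinearSeries.ofScalars ℂ d) 0 := by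
    rw [hasFPowerSeriesAt_iff]
    filter_upwards [Metric.ball_mem_nhds (0 : ℂ) one_pos] with z hz
    have := h z (by simpa using hz)
    simpa [FormalMultilinearSeries.coeff_ofScalars, mul_comm] using this
  have h2 := h1.eq_zero
  rw [← FormalMultilinearSeries.coeff_ofScalars (𝕜 := ℂ) (p := d) (n := n), h2]
  rfl

noncomputable def fF (q : ℂ) : ℂ := phiNeg (q ^ 5) ^ 5 / phiNeg q
noncomputable def gF (q : ℂ) : ℂ := phiNeg (q ^ 5) * phiNeg q ^ 3 - 5 * phiNeg (q ^ 5) ^ 3 * phiNeg q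

lemma root_mul_pow5 {ζ : ℂ} (hζ : IsPrimitiveRoot ζ 5) (q : ℂ) (k : ℕ) : (ζ ^ k * q) ^ 5 = q ^ 5 := by
  rw [mul_pow, ← pow_mul, mul_comm k 5, pow_mul, root_pow5 hζ]; simp

lemma avg_f {ζ q : ℂ} (hζ : IsPrimitiveRoot ζ 5) (hq : ‖q‖ < 1) :
    ∑ k ∈ range 5, fF (ζ ^ k * q) = 5 * (5 * fF (q ^ 5) + gF (q ^ 5)) := by
  have e : (q ^ 5) ^ 5 = q ^ 25 := by ring
  simp only [fF, gF, root_mul_pow5 hζ, e]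
  refine alg_inv hζ (fun k => phiNeg (ζ ^ k * q)) (b := ∑' n, thr q 1 n) (c := ∑' n, thr q 4 n)
    (fun k => ?_) (fun k => phiNeg_ne (norm_root_mul hζ hq k)) (phiNeg_ne (norm_pow_lt hq (by norm_num)))
    (phiNeg_ne (norm_pow_lt hq (by norm_num))) (phiNeg_five hζ hq) (bc_eq hq)
  rw [← thr_zero hq]
  exact phiNeg_root hζ hq k

lemma avg_g {ζ q : ℂ} (hζ : IsPrimitiveRoot ζ 5) (hq : ‖q‖ < 1) :
    ∑ k ∈ range 5, gF (ζ ^ k * q) = 5 * gF (q ^ 5) := by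
  have e : (q ^ 5) ^ 5 = q ^ 25 := by ring
  simp only [gF, root_mul_pow5 hζ, e]
  refine alg_cube hζ (fun k => phiNeg (ζ ^ k * q)) (b := ∑' n, thr q 1 n) (c := ∑' n, thr q 4 n)
    (fun k => ?_) (bc_eq hq)
  rw [← thr_zero hq]
  exact phiNeg_root hζ hq k

theorem stmt_6 (a : ℕ → ℤ)
    (ha : ∀ q : ℂ, ‖q‖ < 1 →
      ∑' n : ℕ, (a n : ℂ) * q ^ n = phiNeg (q ^ 5) ^ 5 / phiNeg q) :
    ∀ n : ℕ, a (25 * n) = 6 * a (5 * n) - 5 * a n := by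
  have hζ := Complex.isPrimitiveRoot_exp 5 (by norm_num)
  generalize Complex.exp (2 * Real.pi * Complex.I / (5 : ℕ)) = ζ at hζ
  have h0 : ∀ q : ℂ, ‖q‖ < 1 → HasSum (fun n => (a n : ℂ) * q ^ n) (fF q) := by
    intro q hq
    have hne : fF q ≠ 0 := div_ne_zero (pow_ne_zero _ (phiNeg_ne (norm_pow_lt hq (by norm_num))))
      (phiNeg_ne hq)
    have h := ha q hq
    change _ = fF q at h
    rw [← h] at hne ⊢
    exact Summable.hasSum (by_contra fun hs => hne (tsum_eq_zero_of_not_summable hs))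
  have h1 := extract hζ (fun n => (a n : ℂ)) fF (fun w => 5 * fF w + gF w) h0
    (fun q hq => avg_f hζ hq)
  have h2 := extract hζ (fun n => (a (5 * n) : ℂ)) _
    (fun w => 5 * (5 * fF w + gF w) + gF w) h1 (fun q hq => by
      rw [sum_add_distrib, ← mul_sum, avg_f hζ hq, avg_g hζ hq]; ring)
  intro n
  have h3 := coeff_zero (fun n => (a (5 * (5 * n)) : ℂ) - 6 * a (5 * n) + 5 * a n) (fun q hq => by
    have := ((h2 q hq).sub ((h1 q hq).mul_left 6)).add ((h0 q hq).mul_left 5)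
    rw [show 5 * (5 * fF q + gF q) + gF q - 6 * (5 * fF q + gF q) + 5 * fF q = 0 by ring] at this
    refine this.congr_fun fun n => ?_
    ring) n
  have h4 : a (5 * (5 * n)) - 6 * a (5 * n) + 5 * a n = 0 := by exact_mod_cast h3
  rw [show 25 * n = 5 * (5 * n) by ring]
  linarith
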